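/- For every n ≥ 1, let η_{4n+2} := e_{2n+1} |⋄ α_{2n+1} ∈ S_{4n+2}. Then η_{4n+2}² = α_{2n+1} ⋄| α_{2n+1}; in particular η_{4n+2}² = θ_{4n+2}² where θ_{4n+2} := α_{2n+1} |⋄ e_{2n+1}. -/

import Mathlib

/-- Reversing of a permutation of `Fin m`: the 0-based version of
`α̃(k) = α(m+1−k)` on `{1,…,m}`. -/
def reversing {m : ℕ} (α : Equiv.Perm (Fin m)) : Equiv.Perm (Fin m) :=
  Fin.revPerm.trans α

/-- Right pasting `α⋄|β`: `(α⋄|β)(i) = α(i)` on the first block and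
`(α⋄|β)(m+j) = β(j)+m` on the second block. -/
def rpaste {m n : ℕ} (α : Equiv.Perm (Fin m)) (β : Equiv.Perm (Fin n)) :
    Equiv.Perm (Fin (m + n)) :=
  finSumFinEquiv.permCongr (Equiv.sumCongr α β)

/-- Left pasting `α|⋄β`: `(α|⋄β)(i) = α(i)+n` on the first block and
`(α|⋄β)(m+j) = β(j)` on the second block. -/
def lpaste {m n : ℕ} (α : Equiv.Perm (Fin m)) (β : Equiv.Perm (Fin n)) :
    Equiv.Perm (Fin (m + n)) :=
  finSumFinEquiv.symm.trans
    (((Equiv.sumCongr α β).trans (Equiv.sumComm (Fin m) (Fin n))).trans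
      (finSumFinEquiv.trans (finCongr (Nat.add_comm n m))))

/-- 0-based version of the Stefan permutation `α_{2n+1}`:
`α(i) = 2n+2−i` for `1 ≤ i ≤ n`, `α(i) = 2n+1−i` for `n+1 ≤ i ≤ 2n`,
`α(2n+1) = n+1` (1-based). -/
def stefanAlphaFun (n : ℕ) (i : ℕ) : ℕ :=
  if i < n then 2 * n - i else if i < 2 * n then 2 * n - 1 - i else n

/-- 0-based version of the Stefan permutation `β_{2n+1}`:
`β(1) = n+1`, `β(i) = 2n+3−i` for `2 ≤ i ≤ n+1`, `β(i) = 2n+2−i` for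
`n+2 ≤ i ≤ 2n+1` (1-based). -/
def stefanBetaFun (n : ℕ) (i : ℕ) : ℕ :=
  if i = 0 then n else if i ≤ n then 2 * n + 1 - i else 2 * n - i

/-- `θ ∈ Sim(4n+2)`: `θ` is a `(4n+2)`-cycle, `θ` interchanges the two blocks
`{1,…,2n+1}` and `{2n+2,…,4n+2}`, `θ²` preserves each block, and the
permutation induced by `θ²` on each block is `α_{2n+1}` or `β_{2n+1}`
(everything written 0-based). -/
def IsSim (n : ℕ) (θ : Equiv.Perm (Fin (4 * n + 2))) : Prop :=
  θ.IsCycle ∧ θ.support = Finset.univ ∧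
  (∀ i : Fin (4 * n + 2), ((i : ℕ) < 2 * n + 1 ↔ 2 * n + 1 ≤ (θ i : ℕ))) ∧
  (∀ i : Fin (4 * n + 2), ((i : ℕ) < 2 * n + 1 ↔ ((θ ^ 2) i : ℕ) < 2 * n + 1)) ∧
  ((∀ i : Fin (4 * n + 2), (i : ℕ) < 2 * n + 1 → ((θ ^ 2) i : ℕ) = stefanAlphaFun n i) ∨
   (∀ i : Fin (4 * n + 2), (i : ℕ) < 2 * n + 1 → ((θ ^ 2) i : ℕ) = stefanBetaFun n i)) ∧
  ((∀ i : Fin (4 * n + 2), 2 * n + 1 ≤ (i : ℕ) →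
      ((θ ^ 2) i : ℕ) = stefanAlphaFun n ((i : ℕ) - (2 * n + 1)) + (2 * n + 1)) ∨
   (∀ i : Fin (4 * n + 2), 2 * n + 1 ≤ (i : ℕ) →
      ((θ ^ 2) i : ℕ) = stefanBetaFun n ((i : ℕ) - (2 * n + 1)) + (2 * n + 1)))

lemma lpaste_castAdd {m n : ℕ} (α : Equiv.Perm (Fin m)) (β : Equiv.Perm (Fin n)) (i : Fin m) :
    lpaste α β (Fin.castAdd n i) = Fin.cast (Nat.add_comm n m) (Fin.natAdd n (α i)) := by
  simp [lpaste]

lemma lpaste_natAdd {m n : ℕ} (α : Equiv.Perm (Fin m)) (β : Equiv.Perm (Fin n)) (j : Fin n) :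
    lpaste α β (Fin.natAdd m j) = Fin.cast (Nat.add_comm n m) (Fin.castAdd m (β j)) := by
  simp [lpaste]

/-- The square of a left pasting of two permutations of the same size is the right pasting of
their two products. -/
lemma lpaste_sq {m : ℕ} (α β : Equiv.Perm (Fin m)) :
    lpaste α β ^ 2 = rpaste (β * α) (α * β) := by
  refine Equiv.ext (Fin.addCases (fun i => ?_) (fun i => ?_)) <;>
    simp only [sq, rpaste, Equiv.Perm.mul_apply, lpaste_castAdd, lpaste_natAdd, Fin.cast_eq_self,
      Equiv.permCongr_apply, finSumFinEquiv_symm_apply_castAdd, finSumFinEquiv_symm_apply_natAdd,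
      Equiv.sumCongr_apply, Sum.map_inl, Sum.map_inr, finSumFinEquiv_apply_left,
      finSumFinEquiv_apply_right]

/-- For `η_{4n+2} := e_{2n+1} |⋄ α_{2n+1}` one has `η_{4n+2}² = α_{2n+1} ⋄| α_{2n+1}`;
in particular `η_{4n+2}² = θ_{4n+2}²` where `θ_{4n+2} := α_{2n+1} |⋄ e_{2n+1}`. -/
theorem eta_sq (n : ℕ) (hn : 1 ≤ n) (α : Equiv.Perm (Fin (2 * n + 1)))
    (hα : ∀ i : Fin (2 * n + 1), (α i : ℕ) = stefanAlphaFun n i) :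
    (lpaste (1 : Equiv.Perm (Fin (2 * n + 1))) α) ^ 2 = rpaste α α ∧
      (lpaste (1 : Equiv.Perm (Fin (2 * n + 1))) α) ^ 2 =
        (lpaste α (1 : Equiv.Perm (Fin (2 * n + 1)))) ^ 2 := by
  simp [lpaste_sq]
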